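/- For any union-free regular expression e, every element r of the star-contraction κ(e) satisfies L(r) ⊆ L(e). -/

import Mathlib

inductive UnionFree {α : Type*} : RegularExpression α → Prop
  | epsilon : UnionFree 1
  | char (a : α) : UnionFree (RegularExpression.char a)
  | comp {e1 e2} : UnionFree e1 → UnionFree e2 → UnionFree (e1 * e2)
  | star {e} : UnionFree e → UnionFree (RegularExpression.star e)

noncomputable def bigUnion {α : Type*} (E : Finset (RegularExpression α)) : RegularExpression α :=
  E.toList.foldr (· + ·) 0

noncomputable def kappa {α : Type*} : RegularExpression α → Set (RegularExpression α)
  | .zero => ∅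
  | .epsilon => {1}
  | .char a => {RegularExpression.char a}
  | .plus _ _ => ∅
  | .comp e1 e2 => {r | ∃ r1 ∈ kappa e1, ∃ r2 ∈ kappa e2, r = r1 * r2}
  | .star e => {r | ∃ E : Finset (RegularExpression α), ↑E ⊆ kappa e ∧ r = (bigUnion E).star}

theorem bigUnion_le_aux {α : Type} (M : Language α) (l : List (RegularExpression α))
    (h : ∀ r ∈ l, r.matches' ≤ M) : (l.foldr (· + ·) 0).matches' ≤ M := by
  induction l with
  | nil => simp
  | cons a l ih =>
    simp only [List.foldr_cons, RegularExpression.matches'_add]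
    exact sup_le (h a (by simp)) (ih fun r hr => h r (by simp [hr]))

/-- Every element of the star-contraction of a union-free regular expression `e`
denotes a sublanguage of `L(e)`. -/
theorem kappa_subset {α : Type} (e : RegularExpression α) (h : UnionFree e) :
    ∀ r ∈ kappa e, r.matches' ≤ e.matches' := by
  induction h with
  | epsilon =>
    intro r hr
    have hr' : r = 1 := hr
    rw [hr']
  | char a =>
    intro r hr
    have hr' : r = RegularExpression.char a := by simpa [kappa] using hr
    rw [hr']
  | @comp e1 e2 _ _ ih1 ih2 =>
    intro r hr
    change r ∈ kappa (RegularExpression.comp e1 e2) at hr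
    rw [kappa] at hr
    obtain ⟨r1, h1, r2, h2, rfl⟩ := hr
    simp only [RegularExpression.matches'_mul]
    exact mul_le_mul' (ih1 r1 h1) (ih2 r2 h2)
  | @star e _ ih =>
    intro r hr
    rw [kappa] at hr
    obtain ⟨E, hE, rfl⟩ := hr
    simp only [RegularExpression.matches'_star]
    apply kstar_mono
    exact bigUnion_le_aux _ _ fun r hr => ih r (hE (by simpa using hr))
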